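/- Let n ≥ 1, fix an index i ∈ {1,…,n}, let f : ℝⁿ → ℝ be continuously differentiable, let b₁, b₂ : ℝ → ℝ be continuously differentiable, and define the vector fields B₁(x) = b₁(f(x)) eᵢ and B₂(x) = b₂(f(x)) eᵢ on ℝⁿ, where eᵢ is the i-th standard basis vector. With b₀(s) = b₂(s) b₁′(s) − b₁(s) b₂′(s), the Lie bracket satisfies [B₁, B₂](x) = − (∂f/∂xᵢ)(x) · b₀(f(x)) · eᵢ for every x ∈ ℝⁿ. -/

import Mathlib

/-- The derivative of `y ↦ b (f y) • e` at `x`, in the direction `v`. -/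
theorem fderiv_comp_smul_const_apply {E F : Type*} [NormedAddCommGroup E] [NormedSpace ℝ E]
    [NormedAddCommGroup F] [NormedSpace ℝ F] {b : ℝ → ℝ} {f : E → ℝ} {x : E}
    (hb : DifferentiableAt ℝ b (f x)) (hf : DifferentiableAt ℝ f x) (e : F) (v : E) :
    fderiv ℝ (fun y => b (f y) • e) x v = (deriv b (f x) * fderiv ℝ f x v) • e := by
  have h : HasFDerivAt (fun y => b (f y)) (deriv b (f x) • fderiv ℝ f x) x :=
    hb.hasDerivAt.comp_hasFDerivAt x hf.hasFDerivAt
  simp [(h.smul_const e).fderiv]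

/-- **Lie bracket of single-direction control vector fields on ℝⁿ.** For
`B₁(x) = b₁(f(x)) eᵢ` and `B₂(x) = b₂(f(x)) eᵢ` with `f : ℝⁿ → ℝ` and `b₁, b₂ : ℝ → ℝ`
continuously differentiable, the Lie bracket
`[B₁, B₂](x) = DB₂(x) B₁(x) − DB₁(x) B₂(x)` equals `−(∂f/∂xᵢ)(x)·b₀(f(x))·eᵢ`,
where `b₀(s) = b₂(s) b₁′(s) − b₁(s) b₂′(s)`. -/
theorem lie_bracket_single_direction (n : ℕ) (hn : 1 ≤ n) (i : Fin n)
    (f : EuclideanSpace ℝ (Fin n) → ℝ) (hf : ContDiff ℝ 1 f)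
    (b₁ b₂ : ℝ → ℝ) (hb₁ : ContDiff ℝ 1 b₁) (hb₂ : ContDiff ℝ 1 b₂)
    (B₁ B₂ : EuclideanSpace ℝ (Fin n) → EuclideanSpace ℝ (Fin n))
    (hB₁ : B₁ = fun x => b₁ (f x) • EuclideanSpace.single i (1:ℝ))
    (hB₂ : B₂ = fun x => b₂ (f x) • EuclideanSpace.single i (1:ℝ))
    (b₀ : ℝ → ℝ) (hb₀ : b₀ = fun s => b₂ s * deriv b₁ s - b₁ s * deriv b₂ s) :
    ∀ x : EuclideanSpace ℝ (Fin n),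
      fderiv ℝ B₂ x (B₁ x) - fderiv ℝ B₁ x (B₂ x) =
        (-(fderiv ℝ f x (EuclideanSpace.single i (1:ℝ)) * b₀ (f x))) •
          EuclideanSpace.single i (1:ℝ) := by
  intro x
  have hfx : DifferentiableAt ℝ f x := hf.differentiable one_ne_zero x
  have hb₁x : DifferentiableAt ℝ b₁ (f x) := hb₁.differentiable one_ne_zero (f x)
  have hb₂x : DifferentiableAt ℝ b₂ (f x) := hb₂.differentiable one_ne_zero (f x)
  subst hB₁ hB₂ hb₀
  rw [fderiv_comp_smul_const_apply hb₂x hfx, fderiv_comp_smul_const_apply hb₁x hfx,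
    map_smul, map_smul, ← sub_smul]
  congr 1
  simp only [smul_eq_mul]
  ring
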